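/- Let f : 𝔻 × 𝔻 → ℂ be a continuous function. Then f is positive definite on Ω_∞ × Ω_∞ if, and only if, f(ξ,η) = Σ_{m,n,k,l∈ℤ₊} a_{m,n,k,l} ξ^m conj(ξ)^n η^k conj(η)^l for (ξ,η) ∈ 𝔻 × 𝔻, where all a_{m,n,k,l} ≥ 0 and Σ a_{m,n,k,l} < ∞. Moreover, this series converges uniformly on 𝔻 × 𝔻. -/

import Mathlib

open scoped ComplexOrder

noncomputable section

/-- The Hilbert space ℓ²(ℂ) of square–summable complex sequences. -/
abbrev Ell2 : Type := lp (fun _ : ℕ => ℂ) 2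

/-- The Hermitian inner product of the paper: `hdot z w = z·w = Σ_j z_j conj(w_j)`. -/
def hdot (z w : Ell2) : ℂ := @inner ℂ _ _ w z

/-- The sphere `Ω_{2q}` (for `q : ℕ∞`), viewed inside ℓ²(ℂ): the unit vectors supported
on the first `q` coordinates; for `q = ⊤` this is the unit sphere `Ω_∞` of ℓ²(ℂ). -/
def Omega (q : ℕ∞) : Set Ell2 :=
  {z | ‖z‖ = 1 ∧ ∀ j : ℕ, q ≤ (j : ℕ∞) → z j = 0}

/-- A kernel `K` is positive definite on a set `S`. -/
def IsPDKernel {α : Type*} (S : Set α) (K : α → α → ℂ) : Prop :=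
  ∀ (L : ℕ) (x : Fin L → α), (∀ i, x i ∈ S) → Function.Injective x →
    ∀ c : Fin L → ℂ, 0 ≤ ∑ μ, ∑ ν, c μ * (starRingEnd ℂ) (c ν) * K (x μ) (x ν)

/-- A kernel `K` is strictly positive definite on a set `S`. -/
def IsSPDKernel {α : Type*} (S : Set α) (K : α → α → ℂ) : Prop :=
  IsPDKernel S K ∧
    ∀ (L : ℕ) (x : Fin L → α), (∀ i, x i ∈ S) → Function.Injective x →
      ∀ c : Fin L → ℂ,
        ∑ μ, ∑ ν, c μ * (starRingEnd ℂ) (c ν) * K (x μ) (x ν) = 0 → c = 0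

/-- `f` is positive definite on `Ω_{2q} × Ω_{2p}`. -/
def PDonProd (q p : ℕ∞) (f : ℂ → ℂ → ℂ) : Prop :=
  IsPDKernel ((Omega q) ×ˢ (Omega p))
    (fun x y => f (hdot x.1 y.1) (hdot x.2 y.2))

/-- `f` is strictly positive definite on `Ω_{2q} × Ω_{2p}`. -/
def SPDonProd (q p : ℕ∞) (f : ℂ → ℂ → ℂ) : Prop :=
  IsSPDKernel ((Omega q) ×ˢ (Omega p))
    (fun x y => f (hdot x.1 y.1) (hdot x.2 y.2))

/-- `g` is positive definite on `Ω_{2q}`. -/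
def PDonSphere (q : ℕ∞) (g : ℂ → ℂ) : Prop :=
  IsPDKernel (Omega q) (fun z z' => g (hdot z z'))

/-- The Jacobi polynomial of degree `k` with (integer) parameters `α, β`, normalized
so that its value at `1` is `1`. -/
def jacobiR (α β k : ℕ) (x : ℝ) : ℝ :=
  (∑ s ∈ Finset.range (k + 1),
      ((k + α).choose (k - s) : ℝ) * ((k + β).choose s : ℝ) *
        ((x - 1) / 2) ^ s * ((x + 1) / 2) ^ (k - s)) /
    ((k + α).choose k : ℝ)

/-- The disc polynomial `R_{m,n}^{q-2}`; for `q = ⊤` (and also `q = 1`) it is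
`ξ^m conj(ξ)^n`.  For `2 ≤ q < ⊤` it equals
`r^{|m-n|} e^{i(m-n)φ} R_{min(m,n)}^{(q-2,|m-n|)}(2r²-1)` for `ξ = r e^{iφ}`. -/
def discR (q : ℕ∞) (m n : ℕ) (ξ : ℂ) : ℂ :=
  if q = ⊤ ∨ q ≤ 1 then ξ ^ m * (starRingEnd ℂ ξ) ^ n
  else (if n ≤ m then ξ ^ (m - n) else (starRingEnd ℂ ξ) ^ (n - m)) *
    ((jacobiR (q.toNat - 2) (max m n - min m n) (min m n)
        (2 * ‖ξ‖ ^ 2 - 1) : ℝ) : ℂ)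

/-- The natural domain `𝔻̃`: the unit circle `∂𝔻` when `q = 1` (the sphere `Ω₂`),
the closed unit disc `𝔻` otherwise. -/
def domD (q : ℕ∞) : Set ℂ :=
  if q = 1 then Metric.sphere (0 : ℂ) 1 else Metric.closedBall (0 : ℂ) 1

/-- `A ⊆ ℤ²` intersects every product of full arithmetic progressions in ℤ. -/
def MeetsAllProgressions (A : Set (ℤ × ℤ)) : Prop :=
  ∀ N M x y : ℤ, 0 < N → 0 < M → 0 < x → 0 < y →
    ∃ v ∈ A, (∃ j : ℤ, v.1 = N * j + x) ∧ (∃ j : ℤ, v.2 = M * j + y)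

open Filter Topology ComplexConjugate

theorem IsPDKernel.sum_nonneg {α T : Type*} [Fintype T] {S : Set α} {K : α → α → ℂ}
    (hK : IsPDKernel S K) (x : T → α) (hxS : ∀ t, x t ∈ S) (hx : Function.Injective x)
    (c : T → ℂ) : 0 ≤ ∑ s, ∑ t, c s * conj (c t) * K (x s) (x t) := by
  let e := (Fintype.equivFin T).symm
  have h := hK (Fintype.card T) (x ∘ e) (fun i => hxS _) (hx.comp e.injective) (c ∘ e)
  rw [← e.sum_comp]
  simpa only [← e.sum_comp (fun t => _ * conj (c t) * K _ (x t)), Function.comp_apply] using h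

/-- The unit vectors of `ℓ²(ℂ)` with `n` leading coordinates of modulus `1 / √n`. -/
theorem exists_sphere_points (n : ℕ) (hn : 0 < n) :
    ∃ x : (Fin n → ℂ) → Ell2,
      (∀ u v, hdot (x u) (x v) = (∑ j, u j * conj (v j)) / n) ∧
      ∀ u, (∀ j, ‖u j‖ = 1) → x u ∈ Omega ⊤ := by
  let b : HilbertBasis ℕ ℂ Ell2 := HilbertBasis.ofRepr (LinearIsometryEquiv.refl ℂ Ell2)
  have hb : Orthonormal ℂ (fun j : Fin n => b j) := b.orthonormal.comp _ Fin.val_injective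
  let x : (Fin n → ℂ) → Ell2 := fun u => ∑ j, (u j / (√n : ℝ)) • b j
  have hn' : (n : ℝ) ≠ 0 := by positivity
  have hx : ∀ u v, hdot (x u) (x v) = (∑ j, u j * conj (v j)) / n := by
    intro u v
    have hs : ((√n : ℝ) : ℂ) * ((√n : ℝ) : ℂ) = n := by
      rw [← Complex.ofReal_mul, Real.mul_self_sqrt (Nat.cast_nonneg n)]
      simp
    have h := hb.inner_sum (fun j => v j / (√n : ℝ)) (fun j => u j / (√n : ℝ)) Finset.univ
    simp only [hdot, x]
    rw [h, Finset.sum_div]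
    refine Finset.sum_congr rfl fun j _ => ?_
    rw [map_div₀, Complex.conj_ofReal, div_mul_div_comm, hs, mul_comm]
  refine ⟨x, hx, fun u hu => ⟨?_, fun j hj => absurd hj (by simp)⟩⟩
  have h : @inner ℂ _ _ (x u) (x u) = 1 := by
    have := hx u u
    simp only [hdot, Complex.mul_conj, Complex.normSq_eq_norm_sq, hu] at this
    rw [this]
    simp [hn.ne']
  rw [inner_self_eq_norm_sq_to_K] at h
  have h2 : ‖x u‖ ^ 2 = 1 := Complex.ofReal_injective (by simpa using h)
  nlinarith [norm_nonneg (x u)]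

section FiniteGroup

variable {G : Type*} [AddCommGroup G] [Fintype G]

/-- The function `u ↦ f (mean of χ₁(u_j)) (mean of χ₂(u_j))` on the power `G ^ n`. -/
def meanFun (f : ℂ → ℂ → ℂ) (χ₁ χ₂ : AddChar G ℂ) (n : ℕ) (u : Fin n → G) : ℂ :=
  f ((∑ j, χ₁ (u j)) / n) ((∑ j, χ₂ (u j)) / n)

theorem meanFun_posDef {f : ℂ → ℂ → ℂ} (hf : PDonProd ⊤ ⊤ f) (χ₁ χ₂ : AddChar G ℂ)
    (hχ : ∀ g h, χ₁ g = χ₁ h → χ₂ g = χ₂ h → g = h) {n : ℕ} (hn : 0 < n)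
    (c : (Fin n → G) → ℂ) :
    0 ≤ ∑ u, ∑ v, c u * conj (c v) * meanFun f χ₁ χ₂ n (u - v) := by
  obtain ⟨x, hx, hxS⟩ := exists_sphere_points n hn
  have hn' : (n : ℂ) ≠ 0 := by exact_mod_cast hn.ne'
  have hsub : ∀ (χ : AddChar G ℂ) (g h : G), χ g * conj (χ h) = χ (g - h) := by
    intro χ g h
    rw [sub_eq_add_neg, AddChar.map_add_eq_mul, AddChar.map_neg_eq_conj]
  have hhd : ∀ (χ : AddChar G ℂ) (u v : Fin n → G),
      hdot (x fun j => χ (u j)) (x fun j => χ (v j)) = (∑ j, χ ((u - v) j)) / n := by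
    intro χ u v
    simp only [hx, hsub, Pi.sub_apply]
  have hxinj : ∀ u v : Fin n → ℂ, x u = x v → (∀ j, ‖u j‖ = 1) → (∀ j, ‖v j‖ = 1) → u = v := by
    intro u v h hu hv
    have h1 : hdot (x u) (x v) = hdot (x v) (x v) := by rw [h]
    have h2 : hdot (x v) (x u) = hdot (x v) (x v) := by rw [h]
    have h3 : hdot (x u) (x u) = hdot (x v) (x v) := by rw [h]
    rw [hx, hx, div_left_inj' hn'] at h1 h2 h3
    have h4 : ∑ j, (u j - v j) * conj (u j - v j) = 0 := by
      simp only [map_sub, sub_mul, mul_sub, Finset.sum_sub_distrib]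
      rw [h1, h2, h3]; ring
    simp only [Complex.mul_conj] at h4
    norm_cast at h4
    rw [Finset.sum_eq_zero_iff_of_nonneg (fun _ _ => Complex.normSq_nonneg _)] at h4
    funext j
    have := h4 j (Finset.mem_univ _)
    rw [Complex.normSq_eq_zero] at this
    exact sub_eq_zero.1 this
  have key := IsPDKernel.sum_nonneg hf
    (fun u : Fin n → G => (x fun j => χ₁ (u j), x fun j => χ₂ (u j)))
    (fun u => ⟨hxS _ fun j => by simp, hxS _ fun j => by simp⟩)
    (by
      intro u v huv
      simp only [Prod.mk.injEq] at huv
      have h1 := hxinj _ _ huv.1 (by simp) (by simp)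
      have h2 := hxinj _ _ huv.2 (by simp) (by simp)
      funext j
      exact hχ _ _ (congrFun h1 j) (congrFun h2 j)) c
  simpa only [hhd, meanFun] using key

/-- The Fourier coefficient of `F : G ^ n → ℂ` at the character `u ↦ ∏ j, α j (u j)`. -/
def fourierCoef {n : ℕ} (F : (Fin n → G) → ℂ) (α : Fin n → AddChar G ℂ) : ℂ :=
  (∑ u, F u * ∏ j, conj (α j (u j))) / (Fintype.card G : ℂ) ^ n

theorem fourierCoef_nonneg {n : ℕ} {F : (Fin n → G) → ℂ}
    (hF : ∀ c : (Fin n → G) → ℂ, 0 ≤ ∑ u, ∑ v, c u * conj (c v) * F (u - v))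
    (α : Fin n → AddChar G ℂ) : 0 ≤ fourierCoef F α := by
  classical
  have h := hF fun u => ∏ j, conj (α j (u j))
  have h1 : ∑ u, ∑ v, (∏ j, conj (α j (u j))) * conj (∏ j, conj (α j (v j))) * F (u - v)
      = (Fintype.card G : ℂ) ^ n * ∑ u, F u * ∏ j, conj (α j (u j)) := by
    rw [Finset.sum_comm]
    have : ∀ v : Fin n → G,
        ∑ u, (∏ j, conj (α j (u j))) * conj (∏ j, conj (α j (v j))) * F (u - v)
          = ∑ u, F u * ∏ j, conj (α j (u j)) := by
      intro v
      rw [← Equiv.sum_comp (Equiv.addRight v)]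
      refine Finset.sum_congr rfl fun u _ => ?_
      simp only [Equiv.coe_addRight, add_sub_cancel_right, ← map_prod, Complex.conj_conj,
        Pi.add_apply, AddChar.map_add_eq_mul, Finset.prod_mul_distrib, map_mul]
      have h2 : (∏ j, conj (α j (v j))) * ∏ j, α j (v j) = 1 := by
        rw [← Finset.prod_mul_distrib]
        refine Finset.prod_eq_one fun j _ => ?_
        rw [mul_comm, Complex.mul_conj, Complex.normSq_eq_norm_sq]
        simp
      rw [← map_prod] at h2
      linear_combination (F u * (conj (∏ j, α j (u j)))) * h2
    rw [Finset.sum_congr rfl fun v _ => this v]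
    simp
  rw [h1] at h
  have hG : (0 : ℂ) < (Fintype.card G : ℂ) ^ n := by
    have : (0 : ℂ) < Fintype.card G := by exact_mod_cast Fintype.card_pos
    positivity
  rw [fourierCoef, ← mul_div_mul_left _ _ hG.ne']
  exact div_nonneg h (mul_nonneg hG.le hG.le)

theorem sum_fourierCoef_mul {n : ℕ} (F : (Fin n → G) → ℂ) (u : Fin n → G) :
    ∑ α, fourierCoef F α * ∏ j, α j (u j) = F u := by
  classical
  have hG : (Fintype.card G : ℂ) ^ n ≠ 0 := by simp
  have h : ∀ v : Fin n → G, ∑ α : Fin n → AddChar G ℂ, ∏ j, (conj (α j (v j)) * α j (u j))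
      = if v = u then (Fintype.card G : ℂ) ^ n else 0 := by
    intro v
    rw [← Fintype.piFinset_univ,
      ← Finset.prod_univ_sum (fun _ => Finset.univ)
        (fun j (ψ : AddChar G ℂ) => conj (ψ (v j)) * ψ (u j))]
    have : ∀ j, ∑ ψ : AddChar G ℂ, conj (ψ (v j)) * ψ (u j)
        = if u j - v j = 0 then (Fintype.card G : ℂ) else 0 := by
      intro j
      rw [← AddChar.sum_apply_eq_ite]
      refine Finset.sum_congr rfl fun ψ _ => ?_
      rw [sub_eq_add_neg, AddChar.map_add_eq_mul, AddChar.map_neg_eq_conj, mul_comm]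
    simp only [this]
    split_ifs with hvu
    · simp [hvu]
    · obtain ⟨j, hj⟩ := Function.ne_iff.1 hvu
      exact Finset.prod_eq_zero (Finset.mem_univ j)
        (if_neg fun h0 => hj (sub_eq_zero.1 h0).symm)
  simp only [fourierCoef, div_mul_eq_mul_div, ← Finset.sum_div]
  rw [div_eq_iff hG]
  simp only [Finset.sum_mul, mul_assoc, ← Finset.prod_mul_distrib]
  rw [Finset.sum_comm]
  simp only [← Finset.mul_sum, h]
  simp

/-- The Fourier transform of a weight on a finite group. -/
def weightHat (ν : G → ℝ) (ψ : AddChar G ℂ) : ℂ := ∑ g, (ν g : ℂ) * ψ g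

theorem sum_weight_mul {n : ℕ} (F : (Fin n → G) → ℂ) (ν : G → ℝ) :
    ∑ u : Fin n → G, ((∏ j, ν (u j) : ℝ) : ℂ) * F u
      = ∑ α, fourierCoef F α * ∏ j, weightHat ν (α j) := by
  classical
  simp only [weightHat]
  simp_rw [Finset.prod_univ_sum, Fintype.piFinset_univ, Finset.mul_sum]
  rw [Finset.sum_comm]
  refine Finset.sum_congr rfl fun u _ => ?_
  conv_lhs => rw [← sum_fourierCoef_mul F u]
  rw [Finset.mul_sum]
  refine Finset.sum_congr rfl fun α _ => ?_
  rw [Finset.prod_mul_distrib]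
  push_cast
  ring

theorem sum_prod_weight {T : Type*} [Fintype T] {ν : T → ℝ} (hν1 : ∑ g, ν g = 1) (n : ℕ) :
    ∑ u : Fin n → T, ∏ j, ν (u j) = 1 := by
  classical
  have := Finset.prod_univ_sum (fun _ : Fin n => (Finset.univ : Finset T)) (fun _ g => ν g)
  rw [Fintype.piFinset_univ] at this
  rw [← this]
  simp [hν1]

theorem sum_weight_mul_norm_sq_sum {T : Type*} [Fintype T] {ν : T → ℝ} (hν1 : ∑ g, ν g = 1)
    (h : T → ℂ)
    (hh : ∑ g, (ν g : ℂ) * h g = 0) (n : ℕ) :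
    ∑ u : Fin n → T, (∏ j, ν (u j)) * ‖∑ j, h (u j)‖ ^ 2 = n * ∑ g, ν g * ‖h g‖ ^ 2 := by
  induction n with
  | zero => simp
  | succ n ih =>
    rw [← (Fin.consEquiv fun _ : Fin (n + 1) => T).sum_comp, Fintype.sum_prod_type]
    simp only [Fin.consEquiv_apply, Fin.prod_univ_succ, Fin.sum_univ_succ, Fin.cons_zero,
      Fin.cons_succ]
    have hexp : ∀ (g : T) (u : Fin n → T),
        ν g * (∏ j, ν (u j)) * ‖h g + ∑ j, h (u j)‖ ^ 2
          = (ν g * ‖h g‖ ^ 2) * (∏ j, ν (u j))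
            + 2 * (((ν g : ℂ) * h g) * (((∏ j, ν (u j) : ℝ) : ℂ) * conj (∑ j, h (u j)))).re
            + ν g * ((∏ j, ν (u j)) * ‖∑ j, h (u j)‖ ^ 2) := by
      intro g u
      have e1 : ((ν g : ℂ) * h g) * (((∏ j, ν (u j) : ℝ) : ℂ) * conj (∑ j, h (u j)))
          = ((ν g * ∏ j, ν (u j) : ℝ) : ℂ) * (h g * conj (∑ j, h (u j))) := by
        rw [Complex.ofReal_mul]; ring
      rw [e1, Complex.re_ofReal_mul, ← Complex.normSq_eq_norm_sq, ← Complex.normSq_eq_norm_sq,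
        ← Complex.normSq_eq_norm_sq, Complex.normSq_add]
      ring
    simp only [hexp, Finset.sum_add_distrib, ← Finset.mul_sum, ← Complex.re_sum, ← Finset.sum_mul]
    rw [ih, sum_prod_weight hν1, hh, hν1]
    push_cast
    simp
    ring

theorem norm_weightHat_le_one {ν : G → ℝ} (hν0 : ∀ g, 0 ≤ ν g)
    (hν1 : ∑ g, ν g = 1) (χ : AddChar G ℂ) : ‖weightHat ν χ‖ ≤ 1 :=
  calc ‖weightHat ν χ‖ ≤ ∑ g, ‖(ν g : ℂ) * χ g‖ := norm_sum_le _ _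
    _ = ∑ g, ν g := by simp [abs_of_nonneg (hν0 _)]
    _ = 1 := hν1

theorem sum_weight_mul_norm_sq_mean_sub_le {ν : G → ℝ} (hν0 : ∀ g, 0 ≤ ν g)
    (hν1 : ∑ g, ν g = 1) (χ : AddChar G ℂ) {n : ℕ} (hn : 0 < n) :
    ∑ u : Fin n → G, (∏ j, ν (u j)) * ‖(∑ j, χ (u j)) / n - weightHat ν χ‖ ^ 2 ≤ 4 / n := by
  have hn' : (0 : ℝ) < n := by exact_mod_cast hn
  have hnorm := norm_weightHat_le_one hν0 hν1 χ
  have hzero : ∑ g, (ν g : ℂ) * (χ g - weightHat ν χ) = 0 := by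
    simp only [mul_sub, Finset.sum_sub_distrib, ← Finset.sum_mul, ← Complex.ofReal_sum, hν1]
    simp [weightHat]
  have hV := sum_weight_mul_norm_sq_sum hν1 _ hzero n
  have hterm : ∀ u : Fin n → G, (∏ j, ν (u j)) * ‖(∑ j, χ (u j)) / n - weightHat ν χ‖ ^ 2
      = ((∏ j, ν (u j)) * ‖∑ j, (χ (u j) - weightHat ν χ)‖ ^ 2) / n ^ 2 := by
    intro u
    have : (∑ j, χ (u j)) / n - weightHat ν χ = (∑ j, (χ (u j) - weightHat ν χ)) / n := by
      have : (n : ℂ) ≠ 0 := by exact_mod_cast hn.ne'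
      rw [Finset.sum_sub_distrib]
      simp
      field_simp
    rw [this, norm_div, div_pow]
    simp
    ring
  simp only [hterm, ← Finset.sum_div]
  rw [hV]
  have hle : ∑ g, ν g * ‖χ g - weightHat ν χ‖ ^ 2 ≤ 4 := by
    calc ∑ g, ν g * ‖χ g - weightHat ν χ‖ ^ 2 ≤ ∑ g, ν g * 4 := by
          refine Finset.sum_le_sum fun g _ => mul_le_mul_of_nonneg_left ?_ (hν0 g)
          have h1 : ‖χ g - weightHat ν χ‖ ≤ 2 := by
            have := norm_sub_le (χ g) (weightHat ν χ)
            have h2 : ‖χ g‖ = 1 := by simp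
            linarith
          nlinarith [norm_nonneg (χ g - weightHat ν χ)]
      _ = 4 := by rw [← Finset.sum_mul, hν1, one_mul]
  rw [div_le_div_iff₀ (by positivity) hn']
  have := mul_le_mul_of_nonneg_left hle (by positivity : (0 : ℝ) ≤ n * n)
  nlinarith

/-- Law of large numbers for the means of characters under independent sampling from `ν`. -/
theorem tendsto_sum_weight_mul_meanFun {f : ℂ → ℂ → ℂ}
    (hf : ContinuousOn (fun v : ℂ × ℂ => f v.1 v.2)
      (Metric.closedBall 0 1 ×ˢ Metric.closedBall 0 1))
    (χ₁ χ₂ : AddChar G ℂ) {ν : G → ℝ} (hν0 : ∀ g, 0 ≤ ν g) (hν1 : ∑ g, ν g = 1) :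
    Tendsto (fun n : ℕ => ∑ u : Fin (n + 1) → G,
        ((∏ j, ν (u j) : ℝ) : ℂ) * meanFun f χ₁ χ₂ (n + 1) u) atTop
      (𝓝 (f (weightHat ν χ₁) (weightHat ν χ₂))) := by
  set m₁ := weightHat ν χ₁ with hm₁
  set m₂ := weightHat ν χ₂ with hm₂
  obtain ⟨M, hM⟩ := ((isCompact_closedBall (0 : ℂ) 1).prod
    (isCompact_closedBall (0 : ℂ) 1)).exists_bound_of_continuousOn hf
  have hmem : ((m₁, m₂) : ℂ × ℂ) ∈
      (Metric.closedBall (0 : ℂ) 1 ×ˢ Metric.closedBall (0 : ℂ) 1 : Set (ℂ × ℂ)) := by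
    simp [hm₁, hm₂, norm_weightHat_le_one hν0 hν1]
  have hM0 : 0 ≤ M := (norm_nonneg _).trans (hM _ hmem)
  rw [Metric.tendsto_atTop]
  intro ε hε
  obtain ⟨δ, hδ, hδf⟩ := Metric.continuousOn_iff.1 hf (m₁, m₂) hmem (ε / 2) (by positivity)
  have hpt : ∀ v ∈ (Metric.closedBall (0 : ℂ) 1 ×ˢ Metric.closedBall (0 : ℂ) 1 : Set (ℂ × ℂ)),
      ‖f v.1 v.2 - f m₁ m₂‖ ≤ ε / 2 + 2 * M / δ ^ 2 * (‖v.1 - m₁‖ ^ 2 + ‖v.2 - m₂‖ ^ 2) := by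
    intro v hv
    by_cases hd : dist v (m₁, m₂) < δ
    · have := hδf v hv hd
      rw [dist_eq_norm] at this
      have h2 : 0 ≤ 2 * M / δ ^ 2 * (‖v.1 - m₁‖ ^ 2 + ‖v.2 - m₂‖ ^ 2) := by positivity
      linarith
    · have h1 : ‖f v.1 v.2 - f m₁ m₂‖ ≤ 2 * M := by
        have := norm_sub_le (f v.1 v.2) (f m₁ m₂)
        have := hM v hv
        have := hM _ hmem
        linarith
      have h2 : δ ^ 2 ≤ ‖v.1 - m₁‖ ^ 2 + ‖v.2 - m₂‖ ^ 2 := by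
        rw [not_lt, Prod.dist_eq, dist_eq_norm, dist_eq_norm, le_max_iff] at hd
        rcases hd with hd | hd
        · nlinarith [sq_nonneg ‖v.2 - m₂‖]
        · nlinarith [sq_nonneg ‖v.1 - m₁‖]
      have h3 : 2 * M ≤ 2 * M / δ ^ 2 * (‖v.1 - m₁‖ ^ 2 + ‖v.2 - m₂‖ ^ 2) := by
        rw [div_mul_eq_mul_div, le_div_iff₀ (by positivity)]
        exact mul_le_mul_of_nonneg_left h2 (by positivity)
      linarith
  obtain ⟨n₀, hn₀⟩ := exists_nat_gt (2 * M / δ ^ 2 * 8 / (ε / 2))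
  refine ⟨n₀, fun n hn => ?_⟩
  have hmean : ∀ (χ : AddChar G ℂ) (u : Fin (n + 1) → G),
      (∑ j, χ (u j)) / ((n + 1 : ℕ) : ℂ) ∈ Metric.closedBall (0 : ℂ) 1 := by
    intro χ u
    rw [mem_closedBall_zero_iff, norm_div, Complex.norm_natCast, div_le_one (by positivity)]
    refine (norm_sum_le _ _).trans ?_
    simp
  have hW0 : ∀ u : Fin (n + 1) → G, 0 ≤ ∏ j, ν (u j) :=
    fun u => Finset.prod_nonneg fun j _ => hν0 _
  have hW1 := sum_prod_weight hν1 (n + 1)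
  rw [dist_eq_norm]
  have hdiff : ∑ u : Fin (n + 1) → G, ((∏ j, ν (u j) : ℝ) : ℂ) * meanFun f χ₁ χ₂ (n + 1) u
        - f m₁ m₂
      = ∑ u : Fin (n + 1) → G,
        ((∏ j, ν (u j) : ℝ) : ℂ) * (meanFun f χ₁ χ₂ (n + 1) u - f m₁ m₂) := by
    simp only [mul_sub, Finset.sum_sub_distrib, ← Finset.sum_mul, ← Complex.ofReal_sum, hW1]
    simp
  rw [hdiff]
  have hK : 0 ≤ 2 * M / δ ^ 2 := by positivity
  have hv1 := sum_weight_mul_norm_sq_mean_sub_le hν0 hν1 χ₁ n.succ_pos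
  have hv2 := sum_weight_mul_norm_sq_mean_sub_le hν0 hν1 χ₂ n.succ_pos
  rw [← hm₁] at hv1
  rw [← hm₂] at hv2
  have hn1 : (0 : ℝ) < ((n + 1 : ℕ) : ℝ) := by positivity
  calc _ ≤ ∑ u : Fin (n + 1) → G, (∏ j, ν (u j)) * ‖meanFun f χ₁ χ₂ (n + 1) u - f m₁ m₂‖ := by
        refine (norm_sum_le _ _).trans (Finset.sum_le_sum fun u _ => ?_)
        rw [norm_mul, Complex.norm_real, Real.norm_of_nonneg (hW0 u)]
    _ ≤ ∑ u : Fin (n + 1) → G, (∏ j, ν (u j)) * (ε / 2 + 2 * M / δ ^ 2 *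
          (‖(∑ j, χ₁ (u j)) / ((n + 1 : ℕ) : ℂ) - m₁‖ ^ 2
            + ‖(∑ j, χ₂ (u j)) / ((n + 1 : ℕ) : ℂ) - m₂‖ ^ 2)) :=
        Finset.sum_le_sum fun u _ => mul_le_mul_of_nonneg_left
          (hpt (_, _) ⟨hmean χ₁ u, hmean χ₂ u⟩) (hW0 u)
    _ = ε / 2 + 2 * M / δ ^ 2 *
          (∑ u : Fin (n + 1) → G, (∏ j, ν (u j)) * ‖(∑ j, χ₁ (u j)) / ((n + 1 : ℕ) : ℂ) - m₁‖ ^ 2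
          + ∑ u : Fin (n + 1) → G,
            (∏ j, ν (u j)) * ‖(∑ j, χ₂ (u j)) / ((n + 1 : ℕ) : ℂ) - m₂‖ ^ 2) := by
        rw [← Finset.sum_add_distrib, Finset.mul_sum]
        conv_rhs => rw [← one_mul (ε / 2), ← hW1, Finset.sum_mul, ← Finset.sum_add_distrib]
        refine Finset.sum_congr rfl fun u _ => ?_
        ring
    _ ≤ ε / 2 + 2 * M / δ ^ 2 * (4 / ((n + 1 : ℕ) : ℝ) + 4 / ((n + 1 : ℕ) : ℝ)) := by
        gcongr
    _ = ε / 2 + 2 * M / δ ^ 2 * 8 / ((n + 1 : ℕ) : ℝ) := by ring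
    _ < ε := by
        have h1 : 2 * M / δ ^ 2 * 8 / ((n + 1 : ℕ) : ℝ) < ε / 2 := by
          rw [div_lt_iff₀ hn1]
          rw [div_lt_iff₀ (by positivity)] at hn₀
          have : (n₀ : ℝ) ≤ ((n + 1 : ℕ) : ℝ) := by exact_mod_cast hn.trans n.le_succ
          nlinarith
        linarith

/-- The multiplicities of the nontrivial characters in a tuple of characters. -/
def charType {n : ℕ} (α : Fin n → AddChar G ℂ) (ψ : {ψ : AddChar G ℂ // ψ ≠ 0}) : ℕ :=
  open Classical in Finset.card {j | α j = ψ}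

theorem prod_weightHat_eq_prod_pow {ν : G → ℝ} (hν1 : ∑ g, ν g = 1) {n : ℕ}
    (α : Fin n → AddChar G ℂ) :
    ∏ j, weightHat ν (α j)
      = ∏ ψ : {ψ : AddChar G ℂ // ψ ≠ 0}, weightHat ν ψ ^ charType α ψ := by
  classical
  have h0 : weightHat ν 0 = 1 := by
    simp only [weightHat, AddChar.zero_apply, mul_one]
    rw [← Complex.ofReal_sum, hν1, Complex.ofReal_one]
  have h1 : ∏ j, weightHat ν (α j)
      = ∏ ψ : AddChar G ℂ, weightHat ν ψ ^ (Finset.card {j | α j = ψ}) := by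
    rw [← Finset.prod_fiberwise Finset.univ α]
    refine Finset.prod_congr rfl fun ψ _ => ?_
    refine Finset.prod_eq_pow_card fun j hj => ?_
    rw [(Finset.mem_filter.1 hj).2]
  have h2 := Finset.prod_subtype (p := fun ψ : AddChar G ℂ => ψ ≠ 0)
    (F := inferInstance) (Finset.univ.erase 0) (by simp)
    (fun ψ : AddChar G ℂ => weightHat ν ψ ^ (Finset.card {j | α j = ψ}))
  rw [Finset.prod_erase _ (by rw [h0, one_pow])] at h2
  rw [h1, h2]
  refine Finset.prod_congr (by congr) fun ψ _ => ?_
  rw [charType]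

end FiniteGroup

theorem summable_prod_pow {ι : Type*} [Fintype ι] {ρ : ι → ℝ} (h0 : ∀ i, 0 ≤ ρ i)
    (h1 : ∀ i, ρ i < 1) : Summable fun n : ι → ℕ => ∏ i, ρ i ^ n i := by
  classical
  refine summable_of_sum_le (c := ∏ i, (1 - ρ i)⁻¹)
    (fun n => Finset.prod_nonneg fun i _ => pow_nonneg (h0 i) _) fun s => ?_
  let t : ι → Finset ℕ := fun i => s.image fun n => n i
  calc ∑ n ∈ s, ∏ i, ρ i ^ n i ≤ ∑ n ∈ Fintype.piFinset t, ∏ i, ρ i ^ n i := by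
        refine Finset.sum_le_sum_of_subset_of_nonneg (fun n hn => ?_)
          fun n _ _ => Finset.prod_nonneg fun i _ => pow_nonneg (h0 i) _
        exact Fintype.mem_piFinset.2 fun i => Finset.mem_image_of_mem _ hn
    _ = ∏ i, ∑ k ∈ t i, ρ i ^ k := (Finset.prod_univ_sum t fun i k => ρ i ^ k).symm
    _ ≤ ∏ i, (1 - ρ i)⁻¹ := by
        refine Finset.prod_le_prod
          (fun i _ => Finset.sum_nonneg fun k _ => pow_nonneg (h0 i) _) fun i _ => ?_
        rw [← tsum_geometric_of_lt_one (h0 i) (h1 i)]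
        exact (summable_geometric_of_lt_one (h0 i) (h1 i)).sum_le_tsum _
          fun k _ => pow_nonneg (h0 i) _

/-- Nonnegative families of total mass at most `M` have a cluster point for the vague topology. -/
theorem exists_vague_limit {I : Type*} (C : ℕ → I → ℝ) {M : ℝ} (h0 : ∀ n i, 0 ≤ C n i)
    (hM : ∀ n (s : Finset I), ∑ i ∈ s, C n i ≤ M) :
    ∃ a : I → ℝ, (∀ i, 0 ≤ a i) ∧ (∀ s : Finset I, ∑ i ∈ s, a i ≤ M) ∧
      ∀ (W : ℕ → I → ℂ) (w : I → ℂ) (b : I → ℝ), Summable b → (∀ n i, ‖W n i‖ ≤ b i) →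
        (∀ i, Tendsto (W · i) atTop (𝓝 (w i))) →
        Tendsto (fun n => ∑' i, (C n i : ℂ) * W n i) (hyperfilter ℕ)
          (𝓝 (∑' i, (a i : ℂ) * w i)) := by
  have hCM : ∀ n i, C n i ≤ M := fun n i => by simpa using hM n {i}
  have hM0 : 0 ≤ M := by simpa using hM 0 ∅
  have hex : ∀ i, ∃ x : ℝ, Tendsto (C · i) (hyperfilter ℕ) (𝓝 x) := by
    intro i
    obtain ⟨x, -, hx⟩ := (isCompact_Icc (a := (0 : ℝ)) (b := M)).ultrafilter_le_nhds
      ((hyperfilter ℕ).map (C · i)) (by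
        rw [Ultrafilter.coe_map, le_principal_iff, mem_map]
        exact Filter.univ_mem' fun n => ⟨h0 n i, hCM n i⟩)
    exact ⟨x, hx⟩
  choose a ha using hex
  refine ⟨a, fun i => ge_of_tendsto' (ha i) fun n => h0 n i, fun s => ?_, ?_⟩
  · exact le_of_tendsto' (tendsto_finsetSum s fun i _ => ha i) fun n => hM n s
  · intro W w b hb hWb hW
    refine tendsto_tsum_of_dominated_convergence (bound := fun i => M * b i) (hb.mul_left M)
      (fun i => ?_) (Filter.Eventually.of_forall fun n i => ?_)
    · exact ((Complex.continuous_ofReal.tendsto _).comp (ha i)).mul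
        ((hW i).mono_left Nat.hyperfilter_le_atTop)
    · rw [norm_mul, Complex.norm_real, Real.norm_of_nonneg (h0 n i)]
      exact mul_le_mul (hCM n i) (hWb n i) (norm_nonneg _) hM0

section FiniteGroup

variable {G : Type*} [AddCommGroup G] [Fintype G]

theorem exists_expansion_finite_group {f : ℂ → ℂ → ℂ}
    (hf : ContinuousOn (fun v : ℂ × ℂ => f v.1 v.2)
      (Metric.closedBall 0 1 ×ˢ Metric.closedBall 0 1))
    (hPD : PDonProd ⊤ ⊤ f) (χ₁ χ₂ : AddChar G ℂ)
    (hχ : ∀ g h, χ₁ g = χ₁ h → χ₂ g = χ₂ h → g = h) :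
    ∃ a : ({ψ : AddChar G ℂ // ψ ≠ 0} → ℕ) → ℝ, (∀ i, 0 ≤ a i) ∧
      (∀ s : Finset _, ∑ i ∈ s, a i ≤ (f 1 1).re) ∧
      ∀ ν : G → ℝ, (∀ g, 0 ≤ ν g) → ∑ g, ν g = 1 →
        (∀ ψ : AddChar G ℂ, ψ ≠ 0 → ‖weightHat ν ψ‖ < 1) →
        f (weightHat ν χ₁) (weightHat ν χ₂)
          = ∑' n, (a n : ℂ) * ∏ ψ : {ψ : AddChar G ℂ // ψ ≠ 0}, weightHat ν ψ ^ n ψ := by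
  classical
  let c : (n : ℕ) → (Fin (n + 1) → AddChar G ℂ) → ℂ :=
    fun n α => fourierCoef (meanFun f χ₁ χ₂ (n + 1)) α
  have hc : ∀ n α, 0 ≤ c n α := fun n α =>
    fourierCoef_nonneg (meanFun_posDef hPD χ₁ χ₂ hχ n.succ_pos) α
  have hcre : ∀ n α, (((c n α).re : ℝ) : ℂ) = c n α := fun n α =>
    (Complex.eq_re_of_ofReal_le (r := 0) (by simpa using hc n α)).symm
  have hc0 : ∀ n α, 0 ≤ (c n α).re := fun n α => (Complex.le_def.1 (hc n α)).1
  have hsum : ∀ n, ∑ α, (c n α).re = (f 1 1).re := by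
    intro n
    have h := sum_fourierCoef_mul (meanFun f χ₁ χ₂ (n + 1)) 0
    have hn : ((n : ℂ) + 1) ≠ 0 := by exact_mod_cast n.succ_ne_zero
    simp [meanFun, hn] at h
    rw [← Complex.re_sum, ← h]
  let C : ℕ → ({ψ : AddChar G ℂ // ψ ≠ 0} → ℕ) → ℝ :=
    fun n i => ∑ α, if i = charType α then (c n α).re else 0
  have hC0 : ∀ n i, 0 ≤ C n i := fun n i =>
    Finset.sum_nonneg fun α _ => by split_ifs; exacts [hc0 n α, le_rfl]
  have hCM : ∀ n (s : Finset _), ∑ i ∈ s, C n i ≤ (f 1 1).re := by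
    intro n s
    rw [← hsum n, Finset.sum_comm]
    refine Finset.sum_le_sum fun α _ => ?_
    rw [Finset.sum_ite_eq']
    split_ifs
    exacts [le_rfl, hc0 n α]
  obtain ⟨a, ha0, haM, ha⟩ := exists_vague_limit C hC0 hCM
  refine ⟨a, ha0, haM, fun ν hν0 hν1 hνlt => ?_⟩
  let w : ({ψ : AddChar G ℂ // ψ ≠ 0} → ℕ) → ℂ := fun i =>
    ∏ ψ : {ψ : AddChar G ℂ // ψ ≠ 0}, weightHat ν ψ ^ i ψ
  have h1 := ha (fun _ => w) w (fun i => ∏ ψ, ‖weightHat ν ψ.1‖ ^ i ψ)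
    (summable_prod_pow (fun ψ => norm_nonneg _) fun ψ => hνlt _ ψ.2)
    (fun n i => by simp [w]) (fun i => tendsto_const_nhds)
  have h2 : ∀ n, ∑' i, (C n i : ℂ) * w i
      = ∑ u : Fin (n + 1) → G, ((∏ j, ν (u j) : ℝ) : ℂ) * meanFun f χ₁ χ₂ (n + 1) u := by
    intro n
    rw [sum_weight_mul]
    have h3 : ∀ i, (C n i : ℂ) * w i
        = ∑ α, if i = charType α then c n α * w (charType α) else 0 := by
      intro i
      simp only [C, Complex.ofReal_sum, Finset.sum_mul]
      refine Finset.sum_congr rfl fun α _ => ?_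
      split_ifs with hi
      · rw [hcre, hi]
      · simp
    simp only [h3]
    rw [Summable.tsum_finsetSum fun α _ => (hasSum_ite_eq _ _).summable]
    simp only [tsum_ite_eq]
    refine Finset.sum_congr rfl fun α _ => ?_
    rw [prod_weightHat_eq_prod_pow hν1]
  simp only [h2] at h1
  exact tendsto_nhds_unique
    ((tendsto_sum_weight_mul_meanFun hf χ₁ χ₂ hν0 hν1).mono_left Nat.hyperfilter_le_atTop) h1

theorem weightHat_neg (ν : G → ℝ) (ψ : AddChar G ℂ) :
    weightHat ν (-ψ) = conj (weightHat ν ψ) := by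
  simp only [weightHat, map_sum, map_mul, Complex.conj_ofReal, AddChar.neg_apply,
    AddChar.map_neg_eq_conj]

/-- The mixture of the uniform distribution and the point mass at `g₀` with weights `1 - r`, `r`. -/
def pointMix (r : ℝ) (g₀ : G) (g : G) : ℝ :=
  open Classical in (1 - r) / Fintype.card G + if g = g₀ then r else 0

theorem pointMix_nonneg {r : ℝ} (h0 : 0 ≤ r) (h1 : r ≤ 1) (g₀ g : G) : 0 ≤ pointMix r g₀ g := by
  have : 0 ≤ 1 - r := by linarith
  unfold pointMix
  positivity

theorem weightHat_pointMix (r : ℝ) (g₀ : G) (ψ : AddChar G ℂ) [Decidable (ψ = 0)] :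
    weightHat (pointMix r g₀) ψ = if ψ = 0 then 1 else r * ψ g₀ := by
  classical
  have h := AddChar.sum_eq_ite ψ
  have hG : (Fintype.card G : ℂ) ≠ 0 := by simp
  simp only [weightHat, pointMix, Complex.ofReal_add, add_mul, Finset.sum_add_distrib]
  have hs : ∑ g, ((if g = g₀ then r else 0 : ℝ) : ℂ) * ψ g = r * ψ g₀ := by
    simp [apply_ite Complex.ofReal, ite_mul]
  rw [← Finset.mul_sum, h, hs]
  push_cast
  split_ifs with h0
  · rw [h0, AddChar.zero_apply]
    field_simp
    ring
  · simp

theorem sum_pointMix (r : ℝ) (g₀ : G) : ∑ g, pointMix r g₀ g = 1 := by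
  classical
  have h := weightHat_pointMix r g₀ 0
  simp only [weightHat, AddChar.zero_apply, mul_one, if_true] at h
  exact_mod_cast h

/-- The density `1 + (Re χ₁ + Re χ₂) / 2` with respect to the uniform distribution. -/
def cosMix (χ₁ χ₂ : AddChar G ℂ) (g : G) : ℝ :=
  (1 + (χ₁ g).re / 2 + (χ₂ g).re / 2) / Fintype.card G

theorem cosMix_nonneg (χ₁ χ₂ : AddChar G ℂ) (g : G) : 0 ≤ cosMix χ₁ χ₂ g := by
  have h : ∀ χ : AddChar G ℂ, -1 ≤ (χ g).re := fun χ => by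
    have := abs_le.1 (Complex.abs_re_le_norm (χ g))
    simpa using this.1
  have h1 := h χ₁
  have h2 := h χ₂
  exact div_nonneg (by linarith) (Nat.cast_nonneg _)

theorem weightHat_cosMix (χ₁ χ₂ ψ : AddChar G ℂ) [DecidableEq (AddChar G ℂ)] :
    weightHat (cosMix χ₁ χ₂) ψ
      = (if ψ = 0 then 1 else 0) + (if ψ = χ₁ then 1 / 4 else 0) + (if ψ = -χ₁ then 1 / 4 else 0)
        + (if ψ = χ₂ then 1 / 4 else 0) + (if ψ = -χ₂ then 1 / 4 else 0) := by
  have hG : (Fintype.card G : ℂ) ≠ 0 := by simp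
  have h : ∀ φ : AddChar G ℂ, ∑ g, φ g * ψ g
      = if ψ = -φ then (Fintype.card G : ℂ) else 0 := by
    intro φ
    have := AddChar.sum_eq_ite (φ + ψ)
    simp only [AddChar.add_apply] at this
    rw [this]
    congr 1
    rw [eq_iff_iff, add_comm, add_eq_zero_iff_eq_neg]
  have hterm : ∀ g, (cosMix χ₁ χ₂ g : ℂ) * ψ g
      = (Fintype.card G : ℂ)⁻¹ * (ψ g + 1 / 4 * ((-χ₁) g * ψ g) + 1 / 4 * (χ₁ g * ψ g)
        + 1 / 4 * ((-χ₂) g * ψ g) + 1 / 4 * (χ₂ g * ψ g)) := by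
    intro g
    simp only [cosMix, AddChar.neg_apply, AddChar.map_neg_eq_conj]
    push_cast
    rw [Complex.re_eq_add_conj, Complex.re_eq_add_conj]
    ring
  simp only [weightHat, hterm, ← Finset.mul_sum, Finset.sum_add_distrib, h, neg_neg]
  rw [AddChar.sum_eq_ite ψ]
  simp only [mul_add, mul_ite, mul_zero, inv_mul_cancel₀ hG]
  have e : (Fintype.card G : ℂ)⁻¹ * (1 / 4 * (Fintype.card G : ℂ)) = 1 / 4 := by field_simp
  rw [e]

theorem sum_cosMix {χ₁ χ₂ : AddChar G ℂ} (h1 : χ₁ ≠ 0) (h2 : χ₂ ≠ 0) :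
    ∑ g, cosMix χ₁ χ₂ g = 1 := by
  classical
  have h := weightHat_cosMix χ₁ χ₂ 0
  simp only [weightHat, AddChar.zero_apply, mul_one, h1.symm, h2.symm,
    (neg_ne_zero.2 h1).symm, (neg_ne_zero.2 h2).symm, if_true, if_false, add_zero] at h
  exact_mod_cast h

/-- The coefficients of an expansion in the Fourier transforms of weights, for a function of
`ν̂(χ₁)` and `ν̂(χ₂)` only, are carried by the characters `± χ₁`, `± χ₂`. -/
theorem coef_eq_zero_of_expansion {f : ℂ → ℂ → ℂ} {χ₁ χ₂ : AddChar G ℂ}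
    (h1 : χ₁ ≠ 0) (h2 : χ₂ ≠ 0) (h11 : χ₁ ≠ -χ₁) (h22 : χ₂ ≠ -χ₂) (h12 : χ₁ ≠ χ₂)
    (h12' : χ₁ ≠ -χ₂) {a : ({ψ : AddChar G ℂ // ψ ≠ 0} → ℕ) → ℝ} (ha0 : ∀ i, 0 ≤ a i)
    (ha : Summable a)
    (hexp : ∀ ν : G → ℝ, (∀ g, 0 ≤ ν g) → ∑ g, ν g = 1 →
        (∀ ψ : AddChar G ℂ, ψ ≠ 0 → ‖weightHat ν ψ‖ < 1) →
        f (weightHat ν χ₁) (weightHat ν χ₂)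
          = ∑' n, (a n : ℂ) * ∏ ψ : {ψ : AddChar G ℂ // ψ ≠ 0}, weightHat ν ψ ^ n ψ)
    (n : {ψ : AddChar G ℂ // ψ ≠ 0} → ℕ) (ψ₀ : {ψ : AddChar G ℂ // ψ ≠ 0}) (hn : n ψ₀ ≠ 0)
    (hψ : ψ₀.1 ≠ χ₁ ∧ ψ₀.1 ≠ -χ₁ ∧ ψ₀.1 ≠ χ₂ ∧ ψ₀.1 ≠ -χ₂) : a n = 0 := by
  classical
  let w : {ψ : AddChar G ℂ // ψ ≠ 0} → ℝ := fun ψ =>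
    if ψ.1 = χ₁ ∨ ψ.1 = -χ₁ ∨ ψ.1 = χ₂ ∨ ψ.1 = -χ₂ then 1 / 4 else 0
  have h21' : χ₂ ≠ -χ₁ := fun h => h12' (by rw [h, neg_neg])
  have hw : ∀ ψ, weightHat (cosMix χ₁ χ₂) ψ.1 = (w ψ : ℂ) := by
    intro ψ
    have hneg : -χ₁ ≠ -χ₂ := fun h => h12 (neg_injective h)
    rw [weightHat_cosMix, if_neg ψ.2]
    simp only [w]
    by_cases e1 : ψ.1 = χ₁
    · simp [e1, h11, h12, h12']
    by_cases e2 : ψ.1 = -χ₁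
    · simp [e2, h11.symm, h21'.symm, h12]
    by_cases e3 : ψ.1 = χ₂
    · simp [e3, h22, h12.symm, h21']
    by_cases e4 : ψ.1 = -χ₂
    · simp [e4, h22.symm, h12'.symm, h12.symm]
    simp [e1, e2, e3, e4]
  have hw0 : ∀ ψ, 0 ≤ w ψ := fun ψ => by simp only [w]; positivity
  have hw4 : ∀ ψ, w ψ ≤ 1 / 4 := fun ψ => by simp only [w]; split_ifs <;> norm_num
  have hP0 : ∀ n : {ψ : AddChar G ℂ // ψ ≠ 0} → ℕ, 0 ≤ ∏ ψ, w ψ ^ n ψ := fun n =>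
    Finset.prod_nonneg fun ψ _ => pow_nonneg (hw0 ψ) _
  have hPQ : ∀ n : {ψ : AddChar G ℂ // ψ ≠ 0} → ℕ,
      ∏ ψ, w ψ ^ n ψ ≤ ∏ ψ, (1 / 4 : ℝ) ^ n ψ := fun n =>
    Finset.prod_le_prod (fun ψ _ => pow_nonneg (hw0 ψ) _)
      fun ψ _ => pow_le_pow_left₀ (hw0 ψ) (hw4 ψ) _
  have hQ1 : ∀ n : {ψ : AddChar G ℂ // ψ ≠ 0} → ℕ, ∏ ψ, (1 / 4 : ℝ) ^ n ψ ≤ 1 := fun n =>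
    Finset.prod_le_one (fun ψ _ => by positivity) fun ψ _ =>
      pow_le_one₀ (by norm_num) (by norm_num)
  have hsQ : Summable fun n => a n * ∏ ψ, (1 / 4 : ℝ) ^ n ψ :=
    ha.of_nonneg_of_le (fun n => mul_nonneg (ha0 n) ((hP0 n).trans (hPQ n)))
      fun n => mul_le_of_le_one_right (ha0 n) (hQ1 n)
  have hsP : Summable fun n => a n * ∏ ψ, w ψ ^ n ψ :=
    hsQ.of_nonneg_of_le (fun n => mul_nonneg (ha0 n) (hP0 n))
      fun n => mul_le_mul_of_nonneg_left (hPQ n) (ha0 n)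
  have hm : ∀ ψ : AddChar G ℂ, ψ ≠ 0 → weightHat (pointMix (1 / 4) (0 : G)) ψ = (1 / 4 : ℝ) := by
    intro ψ hψ
    rw [weightHat_pointMix, if_neg hψ]
    simp
  have hc : ∀ ψ : AddChar G ℂ, (hψ : ψ ≠ 0) → weightHat (cosMix χ₁ χ₂) ψ = (w ⟨ψ, hψ⟩ : ℂ) :=
    fun ψ hψ => hw ⟨ψ, hψ⟩
  have hA := hexp (pointMix (1 / 4) 0) (pointMix_nonneg (by norm_num) (by norm_num) 0)
    (sum_pointMix _ _) (fun ψ hψ => by rw [hm ψ hψ, Complex.norm_real]; norm_num)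
  have hB := hexp (cosMix χ₁ χ₂) (cosMix_nonneg χ₁ χ₂) (sum_cosMix h1 h2)
    (fun ψ hψ => by
      rw [hc ψ hψ, Complex.norm_real, Real.norm_of_nonneg (hw0 _)]
      exact (hw4 _).trans_lt (by norm_num))
  have hw1 : w ⟨χ₁, h1⟩ = 1 / 4 := by simp [w]
  have hw2 : w ⟨χ₂, h2⟩ = 1 / 4 := by simp [w]
  rw [hm χ₁ h1, hm χ₂ h2] at hA
  rw [hc χ₁ h1, hc χ₂ h2, hw1, hw2, hA] at hB
  have hAr : ∀ n : {ψ : AddChar G ℂ // ψ ≠ 0} → ℕ,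
      (a n : ℂ) * ∏ ψ : {ψ : AddChar G ℂ // ψ ≠ 0}, weightHat (pointMix (1 / 4) 0) ψ.1 ^ n ψ
        = ((a n * ∏ ψ, (1 / 4 : ℝ) ^ n ψ : ℝ) : ℂ) := by
    intro n
    rw [Finset.prod_congr rfl fun ψ _ => by rw [hm ψ.1 ψ.2]]
    push_cast
    rfl
  have hBr : ∀ n : {ψ : AddChar G ℂ // ψ ≠ 0} → ℕ,
      (a n : ℂ) * ∏ ψ : {ψ : AddChar G ℂ // ψ ≠ 0}, weightHat (cosMix χ₁ χ₂) ψ.1 ^ n ψ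
        = ((a n * ∏ ψ, w ψ ^ n ψ : ℝ) : ℂ) := by
    intro n
    simp only [hw]
    push_cast
    rfl
  simp only [hAr, hBr, ← Complex.ofReal_tsum] at hB
  have hAB := Complex.ofReal_injective hB
  have hdiff := hsQ.hasSum.sub hsP.hasSum
  rw [hAB, sub_self] at hdiff
  have hz := (hasSum_zero_iff_of_nonneg fun n => sub_nonneg.2
    (mul_le_mul_of_nonneg_left (hPQ n) (ha0 n))).1 hdiff
  have hzn := congrFun hz n
  have hPn : ∏ ψ, w ψ ^ n ψ = 0 := by
    refine Finset.prod_eq_zero (Finset.mem_univ ψ₀) ?_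
    have : w ψ₀ = 0 := by simp [w, hψ]
    rw [this, zero_pow hn]
  simp only [hPn, mul_zero, sub_zero, Pi.zero_apply] at hzn
  have hQn : ∏ ψ, (1 / 4 : ℝ) ^ n ψ ≠ 0 :=
    Finset.prod_ne_zero_iff.2 fun ψ _ => by positivity
  exact (mul_eq_zero.1 hzn).resolve_right hQn

/-- The monomial `ξ ^ m * conj ξ ^ n * η ^ k * conj η ^ l`. -/
def bidiscMonomial (ξ η : ℂ) (i : ℕ × ℕ × ℕ × ℕ) : ℂ :=
  ξ ^ i.1 * (conj ξ) ^ i.2.1 * η ^ i.2.2.1 * (conj η) ^ i.2.2.2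

theorem exists_expansion_two_characters {f : ℂ → ℂ → ℂ}
    (hf : ContinuousOn (fun v : ℂ × ℂ => f v.1 v.2)
      (Metric.closedBall 0 1 ×ˢ Metric.closedBall 0 1))
    (hPD : PDonProd ⊤ ⊤ f) {χ₁ χ₂ : AddChar G ℂ}
    (hχ : ∀ g h, χ₁ g = χ₁ h → χ₂ g = χ₂ h → g = h)
    (h1 : χ₁ ≠ 0) (h2 : χ₂ ≠ 0) (h11 : χ₁ ≠ -χ₁) (h22 : χ₂ ≠ -χ₂) (h12 : χ₁ ≠ χ₂)
    (h12' : χ₁ ≠ -χ₂) :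
    ∃ a : ℕ × ℕ × ℕ × ℕ → ℝ, (∀ i, 0 ≤ a i) ∧
      (∀ s : Finset _, ∑ i ∈ s, a i ≤ (f 1 1).re) ∧
      ∀ ν : G → ℝ, (∀ g, 0 ≤ ν g) → ∑ g, ν g = 1 →
        (∀ ψ : AddChar G ℂ, ψ ≠ 0 → ‖weightHat ν ψ‖ < 1) →
        f (weightHat ν χ₁) (weightHat ν χ₂)
          = ∑' i, (a i : ℂ) * bidiscMonomial (weightHat ν χ₁) (weightHat ν χ₂) i := by
  classical
  obtain ⟨a, ha0, haM, hexp⟩ := exists_expansion_finite_group hf hPD χ₁ χ₂ hχ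
  have ha : Summable a := summable_of_sum_le ha0 haM
  have hzero := coef_eq_zero_of_expansion h1 h2 h11 h22 h12 h12' ha0 ha hexp
  have h21' : χ₂ ≠ -χ₁ := fun h => h12' (by rw [h, neg_neg])
  let q₀ : {ψ : AddChar G ℂ // ψ ≠ 0} := ⟨χ₁, h1⟩
  let q₁ : {ψ : AddChar G ℂ // ψ ≠ 0} := ⟨-χ₁, neg_ne_zero.2 h1⟩
  let q₂ : {ψ : AddChar G ℂ // ψ ≠ 0} := ⟨χ₂, h2⟩
  let q₃ : {ψ : AddChar G ℂ // ψ ≠ 0} := ⟨-χ₂, neg_ne_zero.2 h2⟩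
  have d01 : q₀ ≠ q₁ := fun h => h11 (congrArg Subtype.val h)
  have d02 : q₀ ≠ q₂ := fun h => h12 (congrArg Subtype.val h)
  have d03 : q₀ ≠ q₃ := fun h => h12' (congrArg Subtype.val h)
  have d12 : q₁ ≠ q₂ := fun h => h21' (congrArg Subtype.val h).symm
  have d13 : q₁ ≠ q₃ := fun h => h12 (neg_injective (congrArg Subtype.val h))
  have d23 : q₂ ≠ q₃ := fun h => h22 (congrArg Subtype.val h)
  let E : ℕ × ℕ × ℕ × ℕ → ({ψ : AddChar G ℂ // ψ ≠ 0} → ℕ) := fun i =>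
    Pi.single q₀ i.1 + Pi.single q₁ i.2.1 + Pi.single q₂ i.2.2.1 + Pi.single q₃ i.2.2.2
  have hE0 : ∀ i, E i q₀ = i.1 := fun i => by simp [E, d01, d02, d03]
  have hE1 : ∀ i, E i q₁ = i.2.1 := fun i => by simp [E, d01.symm, d12, d13]
  have hE2 : ∀ i, E i q₂ = i.2.2.1 := fun i => by
    simp [E, d02.symm, d12.symm, d23]
  have hE3 : ∀ i, E i q₃ = i.2.2.2 := fun i => by
    simp [E, d03.symm, d13.symm, d23.symm]
  have hE : Function.Injective E := by
    intro i j hij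
    refine Prod.ext ?_ (Prod.ext ?_ (Prod.ext ?_ ?_))
    · rw [← hE0 i, hij, hE0]
    · rw [← hE1 i, hij, hE1]
    · rw [← hE2 i, hij, hE2]
    · rw [← hE3 i, hij, hE3]
  have hrange : ∀ n, a n ≠ 0 → n ∈ Set.range E := by
    intro n hn
    refine ⟨(n q₀, n q₁, n q₂, n q₃), funext fun ψ => ?_⟩
    by_cases e0 : ψ = q₀
    · rw [e0, hE0]
    by_cases e1 : ψ = q₁
    · rw [e1, hE1]
    by_cases e2 : ψ = q₂
    · rw [e2, hE2]
    by_cases e3 : ψ = q₃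
    · rw [e3, hE3]
    have : n ψ = 0 := by
      by_contra hψ
      exact hn (hzero n ψ hψ ⟨fun h => e0 (Subtype.ext h), fun h => e1 (Subtype.ext h),
        fun h => e2 (Subtype.ext h), fun h => e3 (Subtype.ext h)⟩)
    simp [E, e0, e1, e2, e3, this]
  refine ⟨fun i => a (E i), fun i => ha0 _, fun s => ?_, fun ν hν0 hν1 hνlt => ?_⟩
  · have := haM (s.map ⟨E, hE⟩)
    rwa [Finset.sum_map] at this
  · rw [hexp ν hν0 hν1 hνlt, ← hE.tsum_eq]
    · refine tsum_congr fun i => ?_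
      congr 1
      have hs : ∀ (q : {ψ : AddChar G ℂ // ψ ≠ 0}) (m : ℕ),
          ∏ ψ : {ψ : AddChar G ℂ // ψ ≠ 0},
            weightHat ν ψ.1 ^ (Pi.single q m : {ψ : AddChar G ℂ // ψ ≠ 0} → ℕ) ψ
            = weightHat ν q.1 ^ m := by
        intro q m
        rw [Finset.prod_eq_single q]
        · simp
        · intro ψ _ hψ
          simp [hψ]
        · simp
      simp only [E, Pi.add_apply, pow_add, Finset.prod_mul_distrib, hs, q₀, q₁, q₂, q₃,
        weightHat_neg, bidiscMonomial]
    · intro n hn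
      refine hrange n fun h => hn ?_
      simp [h]

end FiniteGroup

theorem exists_expansion_roots_of_unity {f : ℂ → ℂ → ℂ}
    (hf : ContinuousOn (fun v : ℂ × ℂ => f v.1 v.2)
      (Metric.closedBall 0 1 ×ˢ Metric.closedBall 0 1))
    (hPD : PDonProd ⊤ ⊤ f) (p : ℕ) [NeZero p] (hp : 3 ≤ p) :
    ∃ a : ℕ × ℕ × ℕ × ℕ → ℝ, (∀ i, 0 ≤ a i) ∧
      (∀ s : Finset _, ∑ i ∈ s, a i ≤ (f 1 1).re) ∧
      ∀ (r s : ℝ) (g h : ZMod p), 0 ≤ r → r < 1 → 0 ≤ s → s < 1 →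
        f (r * ZMod.stdAddChar g) (s * ZMod.stdAddChar h)
          = ∑' i, (a i : ℂ) *
              bidiscMonomial (r * ZMod.stdAddChar g) (s * ZMod.stdAddChar h) i := by
  classical
  let χ₁ : AddChar (ZMod p × ZMod p) ℂ :=
    (ZMod.stdAddChar (N := p)).compAddMonoidHom (AddMonoidHom.fst _ _)
  let χ₂ : AddChar (ZMod p × ZMod p) ℂ :=
    (ZMod.stdAddChar (N := p)).compAddMonoidHom (AddMonoidHom.snd _ _)
  have hinj := ZMod.injective_stdAddChar (N := p)
  have a1 : ∀ g, χ₁ g = ZMod.stdAddChar g.1 := fun g => rfl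
  have a2 : ∀ g, χ₂ g = ZMod.stdAddChar g.2 := fun g => rfl
  have hone : (1 : ZMod p) ≠ 0 := by
    have : Fact (1 < p) := ⟨by omega⟩
    exact one_ne_zero
  have htwo : (1 : ZMod p) ≠ -1 := by
    have : Fact (2 < p) := ⟨by omega⟩
    exact (ZMod.neg_one_ne_one).symm
  have ne_of : ∀ {χ χ' : AddChar (ZMod p × ZMod p) ℂ} (g : ZMod p × ZMod p) {x y : ZMod p},
      χ g = ZMod.stdAddChar x → χ' g = ZMod.stdAddChar y → x ≠ y → χ ≠ χ' := by
    intro χ χ' g x y hx hy hxy h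
    rw [h, hy] at hx
    exact hxy (hinj hx).symm
  have e0 : ∀ g, (0 : AddChar (ZMod p × ZMod p) ℂ) g = ZMod.stdAddChar (0 : ZMod p) := by
    intro g; simp
  obtain ⟨a, ha0, haM, ha⟩ := exists_expansion_two_characters hf hPD (χ₁ := χ₁) (χ₂ := χ₂)
    (fun g h h1 h2 => Prod.ext (hinj h1) (hinj h2))
    (ne_of (1, 0) (a1 _) (e0 _) hone) (ne_of (0, 1) (a2 _) (e0 _) hone)
    (ne_of (1, 0) (a1 _) (AddChar.neg_apply _ _) htwo)
    (ne_of (0, 1) (a2 _) (AddChar.neg_apply _ _) htwo)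
    (ne_of (1, 0) (a1 _) (a2 _) hone)
    (ne_of (1, 0) (a1 _) (AddChar.neg_apply _ _) (by simpa using hone))
  refine ⟨a, ha0, haM, fun r s g h hr0 hr1 hs0 hs1 => ?_⟩
  let ν : ZMod p × ZMod p → ℝ := fun x => pointMix r g x.1 * pointMix s h x.2
  have hhat : ∀ ψ : AddChar (ZMod p × ZMod p) ℂ, weightHat ν ψ
      = weightHat (pointMix r g) (ψ.compAddMonoidHom (AddMonoidHom.inl _ _))
        * weightHat (pointMix s h) (ψ.compAddMonoidHom (AddMonoidHom.inr _ _)) := by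
    intro ψ
    simp only [weightHat]
    rw [Finset.sum_mul_sum, Fintype.sum_prod_type]
    refine Finset.sum_congr rfl fun x _ => Finset.sum_congr rfl fun y _ => ?_
    have : ψ (x, y) = ψ (x, 0) * ψ (0, y) := by
      rw [← AddChar.map_add_eq_mul]; simp
    simp only [ν, this, AddChar.compAddMonoidHom_apply, AddMonoidHom.inl_apply,
      AddMonoidHom.inr_apply]
    push_cast
    ring
  have hle : ∀ (r : ℝ) (g : ZMod p) (φ : AddChar (ZMod p) ℂ), 0 ≤ r → r < 1 →
      ‖weightHat (pointMix r g) φ‖ ≤ 1 ∧ (φ ≠ 0 → ‖weightHat (pointMix r g) φ‖ < 1) := by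
    intro r g φ h0 h1
    refine ⟨norm_weightHat_le_one (pointMix_nonneg h0 h1.le g) (sum_pointMix r g) φ, fun hφ => ?_⟩
    rw [weightHat_pointMix, if_neg hφ]
    simpa [abs_of_nonneg h0] using h1
  have hν0 : ∀ x, 0 ≤ ν x := fun x =>
    mul_nonneg (pointMix_nonneg hr0 hr1.le _ _) (pointMix_nonneg hs0 hs1.le _ _)
  have hν1 : ∑ x, ν x = 1 := by
    rw [Fintype.sum_prod_type]
    simp only [ν, ← Finset.mul_sum, sum_pointMix, mul_one]
  have hνlt : ∀ ψ : AddChar (ZMod p × ZMod p) ℂ, ψ ≠ 0 → ‖weightHat ν ψ‖ < 1 := by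
    intro ψ hψ
    rw [hhat, norm_mul]
    obtain ⟨hl, hl'⟩ := hle r g (ψ.compAddMonoidHom (AddMonoidHom.inl _ _)) hr0 hr1
    obtain ⟨hr, hr'⟩ := hle s h (ψ.compAddMonoidHom (AddMonoidHom.inr _ _)) hs0 hs1
    by_cases h1 : ψ.compAddMonoidHom (AddMonoidHom.inl (ZMod p) (ZMod p)) = 0
    · have h2 : ψ.compAddMonoidHom (AddMonoidHom.inr (ZMod p) (ZMod p)) ≠ 0 := by
        intro h2
        refine hψ (DFunLike.ext _ _ fun x => ?_)
        have h3 : ψ (x.1, 0) = 1 := by simpa using DFunLike.congr_fun h1 x.1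
        have h4 : ψ (0, x.2) = 1 := by simpa using DFunLike.congr_fun h2 x.2
        have : ψ x = ψ (x.1, 0) * ψ (0, x.2) := by rw [← AddChar.map_add_eq_mul]; simp
        rw [this, h3, h4]; simp
      nlinarith [hr' h2, norm_nonneg (weightHat (pointMix s h)
        (ψ.compAddMonoidHom (AddMonoidHom.inr (ZMod p) (ZMod p))))]
    · nlinarith [hl' h1, norm_nonneg (weightHat (pointMix r g)
        (ψ.compAddMonoidHom (AddMonoidHom.inl (ZMod p) (ZMod p)))),
        norm_nonneg (weightHat (pointMix s h)
        (ψ.compAddMonoidHom (AddMonoidHom.inr (ZMod p) (ZMod p))))]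
  have hstd : (ZMod.stdAddChar (N := p)) ≠ 0 := by
    intro h0
    exact hone (hinj (by rw [h0]; simp))
  have hχ1 : weightHat ν χ₁ = r * ZMod.stdAddChar g := by
    have e1 : χ₁.compAddMonoidHom (AddMonoidHom.inl _ _) = ZMod.stdAddChar :=
      DFunLike.ext _ _ fun x => rfl
    have e2 : χ₁.compAddMonoidHom (AddMonoidHom.inr _ _) = 0 :=
      DFunLike.ext _ _ fun x => by simp [a1]
    rw [hhat, e1, e2, weightHat_pointMix, weightHat_pointMix, if_neg hstd, if_pos rfl, mul_one]
  have hχ2 : weightHat ν χ₂ = s * ZMod.stdAddChar h := by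
    have e1 : χ₂.compAddMonoidHom (AddMonoidHom.inr _ _) = ZMod.stdAddChar :=
      DFunLike.ext _ _ fun x => rfl
    have e2 : χ₂.compAddMonoidHom (AddMonoidHom.inl _ _) = 0 :=
      DFunLike.ext _ _ fun x => by simp [a2]
    rw [hhat, e1, e2, weightHat_pointMix, weightHat_pointMix, if_neg hstd, if_pos rfl, one_mul]
  have := ha ν hν0 hν1 hνlt
  rwa [hχ1, hχ2] at this

theorem exists_tendsto_roots_of_unity (ξ : ℂ) :
    ∃ g : (k : ℕ) → ZMod (k + 3),
      Tendsto (fun k => (‖ξ‖ : ℂ) * ZMod.stdAddChar (g k)) atTop (𝓝 ξ) := by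
  let t : ℝ := ξ.arg / (2 * Real.pi)
  refine ⟨fun k => ((⌊t * ((k + 3 : ℕ) : ℝ)⌋ : ℤ) : ZMod (k + 3)), ?_⟩
  have h1 : Tendsto (fun k : ℕ => (⌊t * ((k + 3 : ℕ) : ℝ)⌋ : ℝ) / ((k + 3 : ℕ) : ℝ)) atTop
      (𝓝 t) := by
    have h2 : Tendsto (fun k : ℕ => t - 1 / ((k + 3 : ℕ) : ℝ)) atTop (𝓝 t) := by
      have := (tendsto_const_div_atTop_nhds_zero_nat (1 : ℝ)).comp (tendsto_add_atTop_nat 3)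
      simpa using this.const_sub t
    refine tendsto_of_tendsto_of_tendsto_of_le_of_le h2 tendsto_const_nhds (fun k => ?_)
      fun k => ?_
    · have hk : (0 : ℝ) < ((k + 3 : ℕ) : ℝ) := by positivity
      have := Int.sub_one_lt_floor (t * ((k + 3 : ℕ) : ℝ))
      simp only
      rw [le_div_iff₀ hk, sub_mul, one_div, inv_mul_cancel₀ hk.ne']
      exact this.le
    · have hk : (0 : ℝ) < ((k + 3 : ℕ) : ℝ) := by positivity
      simp only
      rw [div_le_iff₀ hk]
      exact Int.floor_le _
  have h3 : Tendsto (fun k : ℕ => (‖ξ‖ : ℂ) * Complex.exp (2 * Real.pi * Complex.I *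
      (((⌊t * ((k + 3 : ℕ) : ℝ)⌋ : ℝ) / ((k + 3 : ℕ) : ℝ) : ℝ) : ℂ))) atTop
      (𝓝 ((‖ξ‖ : ℂ) * Complex.exp (2 * Real.pi * Complex.I * (t : ℂ)))) := by
    have hc : Continuous fun x : ℝ =>
        (‖ξ‖ : ℂ) * Complex.exp (2 * Real.pi * Complex.I * (x : ℂ)) := by fun_prop
    exact (hc.tendsto t).comp h1
  have h4 : (‖ξ‖ : ℂ) * Complex.exp (2 * Real.pi * Complex.I * (t : ℂ)) = ξ := by
    conv_rhs => rw [← Complex.norm_mul_exp_arg_mul_I ξ]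
    congr 2
    have : (Real.pi : ℂ) ≠ 0 := by exact_mod_cast Real.pi_ne_zero
    simp only [t]
    push_cast
    field_simp
  rw [h4] at h3
  refine h3.congr fun k => ?_
  rw [ZMod.stdAddChar_coe]
  congr 2
  push_cast
  ring

theorem norm_bidiscMonomial (ξ η : ℂ) (i : ℕ × ℕ × ℕ × ℕ) :
    ‖bidiscMonomial ξ η i‖
      = ‖ξ‖ ^ i.1 * ‖ξ‖ ^ i.2.1 * ‖η‖ ^ i.2.2.1 * ‖η‖ ^ i.2.2.2 := by
  simp [bidiscMonomial]

theorem norm_bidiscMonomial_le_one {ξ η : ℂ} (hξ : ‖ξ‖ ≤ 1) (hη : ‖η‖ ≤ 1)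
    (i : ℕ × ℕ × ℕ × ℕ) : ‖bidiscMonomial ξ η i‖ ≤ 1 := by
  have h : ∀ {x : ℝ} (n : ℕ), 0 ≤ x → x ≤ 1 → x ^ n ≤ 1 := fun n h0 h1 => pow_le_one₀ h0 h1
  rw [norm_bidiscMonomial]
  refine mul_le_one₀ (mul_le_one₀ (mul_le_one₀ ?_ ?_ ?_) ?_ ?_) ?_ ?_ <;>
    first | positivity | exact h _ (norm_nonneg _) ‹_›

theorem summable_norm_bidiscMonomial {ξ η : ℂ} (hξ : ‖ξ‖ < 1) (hη : ‖η‖ < 1) :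
    Summable fun i => ‖bidiscMonomial ξ η i‖ := by
  have hx := summable_geometric_of_lt_one (norm_nonneg ξ) hξ
  have hy := summable_geometric_of_lt_one (norm_nonneg η) hη
  have h0 : ∀ (x : ℂ) (n : ℕ), 0 ≤ ‖x‖ ^ n := fun x n => by positivity
  have h1 := hy.mul_of_nonneg hy (h0 η) (h0 η)
  have h2 := hx.mul_of_nonneg h1 (h0 ξ) fun i => mul_nonneg (h0 η _) (h0 η _)
  have h3 := hx.mul_of_nonneg h2 (h0 ξ) fun i =>
    mul_nonneg (h0 ξ _) (mul_nonneg (h0 η _) (h0 η _))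
  refine h3.congr fun i => ?_
  rw [norm_bidiscMonomial]
  ring

theorem tendsto_bidiscMonomial {ι : Type*} {l : Filter ι} {x y : ι → ℂ} {ξ η : ℂ}
    (hx : Tendsto x l (𝓝 ξ)) (hy : Tendsto y l (𝓝 η)) (i : ℕ × ℕ × ℕ × ℕ) :
    Tendsto (fun k => bidiscMonomial (x k) (y k) i) l (𝓝 (bidiscMonomial ξ η i)) := by
  have hx' : Tendsto (fun k => conj (x k)) l (𝓝 (conj ξ)) :=
    (Complex.continuous_conj.tendsto ξ).comp hx
  have hy' : Tendsto (fun k => conj (y k)) l (𝓝 (conj η)) :=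
    (Complex.continuous_conj.tendsto η).comp hy
  have h := (((hx.pow i.1).mul (hx'.pow i.2.1)).mul (hy.pow i.2.2.1)).mul (hy'.pow i.2.2.2)
  simpa only [bidiscMonomial, mul_assoc] using h

theorem tendsto_of_continuousOn_bidisc {ι : Type*} {l : Filter ι} {f : ℂ → ℂ → ℂ}
    (hf : ContinuousOn (fun v : ℂ × ℂ => f v.1 v.2)
      (Metric.closedBall 0 1 ×ˢ Metric.closedBall 0 1))
    {x y : ι → ℂ} {ξ η : ℂ} (hx : Tendsto x l (𝓝 ξ)) (hy : Tendsto y l (𝓝 η))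
    (hξ : ‖ξ‖ ≤ 1) (hη : ‖η‖ ≤ 1) (hx1 : ∀ k, ‖x k‖ ≤ 1) (hy1 : ∀ k, ‖y k‖ ≤ 1) :
    Tendsto (fun k => f (x k) (y k)) l (𝓝 (f ξ η)) := by
  have h : ContinuousWithinAt (fun v : ℂ × ℂ => f v.1 v.2)
      (Metric.closedBall 0 1 ×ˢ Metric.closedBall 0 1) (ξ, η) :=
    hf _ ⟨mem_closedBall_zero_iff.2 hξ, mem_closedBall_zero_iff.2 hη⟩
  exact Tendsto.comp (g := fun v : ℂ × ℂ => f v.1 v.2) h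
    (tendsto_nhdsWithin_iff.2 ⟨hx.prodMk_nhds hy, Filter.Eventually.of_forall fun k =>
      ⟨mem_closedBall_zero_iff.2 (hx1 k), mem_closedBall_zero_iff.2 (hy1 k)⟩⟩)

theorem exists_expansion_open_bidisc {f : ℂ → ℂ → ℂ}
    (hf : ContinuousOn (fun v : ℂ × ℂ => f v.1 v.2)
      (Metric.closedBall 0 1 ×ˢ Metric.closedBall 0 1))
    (hPD : PDonProd ⊤ ⊤ f) :
    ∃ a : ℕ × ℕ × ℕ × ℕ → ℝ, (∀ i, 0 ≤ a i) ∧ Summable a ∧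
      ∀ ξ η : ℂ, ‖ξ‖ < 1 → ‖η‖ < 1 → f ξ η = ∑' i, (a i : ℂ) * bidiscMonomial ξ η i := by
  choose C hC0 hCM hC using fun k : ℕ =>
    exists_expansion_roots_of_unity hf hPD (k + 3) (Nat.le_add_left 3 k)
  obtain ⟨a, ha0, haM, ha⟩ := exists_vague_limit C hC0 hCM
  refine ⟨a, ha0, summable_of_sum_le ha0 haM, fun ξ η hξ hη => ?_⟩
  obtain ⟨g, hg⟩ := exists_tendsto_roots_of_unity ξ
  obtain ⟨h, hh⟩ := exists_tendsto_roots_of_unity η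
  have hfC := fun k => hC k _ _ (g k) (h k) (norm_nonneg ξ) hξ (norm_nonneg η) hη
  have hx : ∀ k, ‖(‖ξ‖ : ℂ) * ZMod.stdAddChar (g k)‖ = ‖ξ‖ := fun k => by simp
  have hy : ∀ k, ‖(‖η‖ : ℂ) * ZMod.stdAddChar (h k)‖ = ‖η‖ := fun k => by simp
  have h1 := ha _ _ (fun i => ‖bidiscMonomial ξ η i‖) (summable_norm_bidiscMonomial hξ hη)
    (fun k i => by rw [norm_bidiscMonomial, norm_bidiscMonomial, hx, hy])
    (tendsto_bidiscMonomial hg hh)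
  have h2 := tendsto_of_continuousOn_bidisc hf hg hh hξ.le hη.le
    (fun k => (hx k).trans_le hξ.le) fun k => (hy k).trans_le hη.le
  exact tendsto_nhds_unique (h2.mono_left Nat.hyperfilter_le_atTop)
    (h1.congr fun k => (hfC k).symm)

theorem exists_expansion_of_PDonProd {f : ℂ → ℂ → ℂ}
    (hf : ContinuousOn (fun v : ℂ × ℂ => f v.1 v.2)
      (Metric.closedBall 0 1 ×ˢ Metric.closedBall 0 1))
    (hPD : PDonProd ⊤ ⊤ f) :
    ∃ a : ℕ × ℕ × ℕ × ℕ → ℝ, (∀ i, 0 ≤ a i) ∧ Summable a ∧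
      ∀ ξ ∈ Metric.closedBall (0 : ℂ) 1, ∀ η ∈ Metric.closedBall (0 : ℂ) 1,
        f ξ η = ∑' i, (a i : ℂ) * bidiscMonomial ξ η i := by
  obtain ⟨a, ha0, hsum, hopen⟩ := exists_expansion_open_bidisc hf hPD
  refine ⟨a, ha0, hsum, fun ξ hξ η hη => ?_⟩
  have hξ' : ‖ξ‖ ≤ 1 := by simpa using hξ
  have hη' : ‖η‖ ≤ 1 := by simpa using hη
  let t : ℕ → ℂ := fun k => (k : ℂ) / (k + 1)
  have ht : Tendsto t atTop (𝓝 1) := by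
    simpa using tendsto_natCast_div_add_atTop (𝕜 := ℂ) (1 : ℂ)
  have htn : ∀ k, ‖t k‖ < 1 := by
    intro k
    have : ‖(k : ℂ) + 1‖ = (k : ℝ) + 1 := by exact_mod_cast Complex.norm_natCast (k + 1)
    simp only [t, norm_div, this, Complex.norm_natCast]
    rw [div_lt_one (by positivity)]
    linarith
  have hlt : ∀ (x : ℂ) k, ‖x‖ ≤ 1 → ‖t k * x‖ < 1 := fun x k hx => by
    rw [norm_mul]
    nlinarith [htn k, norm_nonneg (t k), norm_nonneg x]
  have hx : Tendsto (fun k => t k * ξ) atTop (𝓝 ξ) := by simpa using ht.mul_const ξ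
  have hy : Tendsto (fun k => t k * η) atTop (𝓝 η) := by simpa using ht.mul_const η
  have h1 : Tendsto (fun k => f (t k * ξ) (t k * η)) atTop (𝓝 (f ξ η)) :=
    tendsto_of_continuousOn_bidisc hf hx hy hξ' hη' (fun k => (hlt ξ k hξ').le)
      fun k => (hlt η k hη').le
  have h2 : Tendsto (fun k => ∑' i, (a i : ℂ) * bidiscMonomial (t k * ξ) (t k * η) i) atTop
      (𝓝 (∑' i, (a i : ℂ) * bidiscMonomial ξ η i)) := by
    refine tendsto_tsum_of_dominated_convergence hsum
      (fun i => (tendsto_bidiscMonomial hx hy i).const_mul _)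
      (Filter.Eventually.of_forall fun k i => ?_)
    rw [norm_mul, Complex.norm_real, Real.norm_of_nonneg (ha0 i)]
    exact mul_le_of_le_one_right (ha0 i)
      (norm_bidiscMonomial_le_one (hlt ξ k hξ').le (hlt η k hη').le i)
  refine tendsto_nhds_unique h1 (h2.congr fun k => ?_)
  exact (hopen _ _ (hlt ξ k hξ') (hlt η k hη')).symm

theorem Matrix.PosSemidef.map_pow {ι : Type*} [Finite ι] {A : Matrix ι ι ℂ}
    (hA : A.PosSemidef) (m : ℕ) : (A.map (· ^ m)).PosSemidef := by
  induction m with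
  | zero =>
    have h := Matrix.posSemidef_vecMulVec_self_star (fun _ : ι => (1 : ℂ))
    have e : A.map (· ^ 0) = Matrix.vecMulVec (fun _ : ι => (1 : ℂ)) (star fun _ => 1) := by
      ext i j
      simp [Matrix.vecMulVec]
    rwa [e]
  | succ m ih =>
    have e : A.map (· ^ (m + 1)) = (A.map (· ^ m)).hadamard A := by
      ext i j
      simp [pow_succ]
    rw [e]
    exact ih.hadamard hA

theorem posSemidef_hdot {ι : Type*} [Finite ι] (x : ι → Ell2) :
    (Matrix.of fun i j => hdot (x i) (x j)).PosSemidef :=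
  (Matrix.posSemidef_gram ℂ x).transpose

theorem posSemidef_conj_hdot {ι : Type*} [Finite ι] (x : ι → Ell2) :
    (Matrix.of fun i j => conj (hdot (x i) (x j))).PosSemidef := by
  have e : (Matrix.of fun i j => conj (hdot (x i) (x j))) = Matrix.gram ℂ x := by
    ext i j
    simp [hdot, Matrix.gram]
  rw [e]
  exact Matrix.posSemidef_gram ℂ x

theorem sum_bidiscMonomial_nonneg {ι : Type*} [Fintype ι] (x y : ι → Ell2) (c : ι → ℂ)
    (i : ℕ × ℕ × ℕ × ℕ) :
    0 ≤ ∑ s, ∑ t, c s * conj (c t) * bidiscMonomial (hdot (x s) (x t)) (hdot (y s) (y t)) i := by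
  have h := ((((posSemidef_hdot x).map_pow i.1).hadamard
    ((posSemidef_conj_hdot x).map_pow i.2.1)).hadamard
    ((posSemidef_hdot y).map_pow i.2.2.1)).hadamard ((posSemidef_conj_hdot y).map_pow i.2.2.2)
  convert h.dotProduct_mulVec_nonneg (star c) using 1
  simp only [star_star, dotProduct, Matrix.mulVec, Finset.mul_sum, bidiscMonomial]
  refine Finset.sum_congr rfl fun s _ => Finset.sum_congr rfl fun t _ => ?_
  simp only [Matrix.hadamard_apply, Matrix.map_apply, Matrix.of_apply, Pi.star_apply,
    RCLike.star_def]
  ring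

theorem norm_hdot_le_one {z w : Ell2} (hz : z ∈ Omega ⊤) (hw : w ∈ Omega ⊤) :
    ‖hdot z w‖ ≤ 1 := by
  have := norm_inner_le_norm (𝕜 := ℂ) w z
  rwa [hz.1, hw.1, one_mul] at this

theorem summable_mul_bidiscMonomial {a : ℕ × ℕ × ℕ × ℕ → ℝ} (ha0 : ∀ i, 0 ≤ a i)
    (ha : Summable a) {ξ η : ℂ} (hξ : ‖ξ‖ ≤ 1) (hη : ‖η‖ ≤ 1) :
    Summable fun i => (a i : ℂ) * bidiscMonomial ξ η i := by
  refine ha.of_norm_bounded fun i => ?_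
  rw [norm_mul, Complex.norm_real, Real.norm_of_nonneg (ha0 i)]
  exact mul_le_of_le_one_right (ha0 i) (norm_bidiscMonomial_le_one hξ hη i)

theorem PDonProd_of_expansion {f : ℂ → ℂ → ℂ} {a : ℕ × ℕ × ℕ × ℕ → ℝ} (ha0 : ∀ i, 0 ≤ a i)
    (ha : Summable a)
    (hexp : ∀ ξ ∈ Metric.closedBall (0 : ℂ) 1, ∀ η ∈ Metric.closedBall (0 : ℂ) 1,
        f ξ η = ∑' i, (a i : ℂ) * bidiscMonomial ξ η i) : PDonProd ⊤ ⊤ f := by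
  intro L x hx _ c
  have h1 : ∀ s t, ‖hdot (x s).1 (x t).1‖ ≤ 1 := fun s t => norm_hdot_le_one (hx s).1 (hx t).1
  have h2 : ∀ s t, ‖hdot (x s).2 (x t).2‖ ≤ 1 := fun s t => norm_hdot_le_one (hx s).2 (hx t).2
  have hS : HasSum (fun i => ∑ s, ∑ t, c s * conj (c t) *
      ((a i : ℂ) * bidiscMonomial (hdot (x s).1 (x t).1) (hdot (x s).2 (x t).2) i))
      (∑ s, ∑ t, c s * conj (c t) * f (hdot (x s).1 (x t).1) (hdot (x s).2 (x t).2)) := by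
    refine hasSum_sum fun s _ => hasSum_sum fun t _ => HasSum.mul_left _ ?_
    rw [hexp _ (by simpa using h1 s t) _ (by simpa using h2 s t)]
    exact (summable_mul_bidiscMonomial ha0 ha (h1 s t) (h2 s t)).hasSum
  refine hS.nonneg fun i => ?_
  have h3 := sum_bidiscMonomial_nonneg (fun s => (x s).1) (fun s => (x s).2) c i
  have h4 := mul_nonneg (Complex.zero_le_real.2 (ha0 i)) h3
  simp only [Finset.mul_sum] at h4
  refine h4.trans_eq (Finset.sum_congr rfl fun s _ => Finset.sum_congr rfl fun t _ => ?_)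
  ring

/-- Theorem 5.1 / `th_PDinfty`: a continuous `f : 𝔻 × 𝔻 → ℂ` is PD
on `Ω_∞ × Ω_∞` iff it has an expansion `Σ a_{m,n,k,l} ξ^m conj(ξ)^n η^k conj(η)^l`
with nonnegative summable coefficients; moreover the series converges uniformly
on `𝔻 × 𝔻`. -/
theorem stmt3 (f : ℂ → ℂ → ℂ)
    (hf : ContinuousOn (fun v : ℂ × ℂ => f v.1 v.2)
      (Metric.closedBall 0 1 ×ˢ Metric.closedBall 0 1)) :
    PDonProd ⊤ ⊤ f ↔
      ∃ a : ℕ × ℕ × ℕ × ℕ → ℝ, (∀ i, 0 ≤ a i) ∧ Summable a ∧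
        (∀ ξ ∈ Metric.closedBall (0 : ℂ) 1, ∀ η ∈ Metric.closedBall (0 : ℂ) 1,
          f ξ η = ∑' i : ℕ × ℕ × ℕ × ℕ,
            (a i : ℂ) * ξ ^ i.1 * (starRingEnd ℂ ξ) ^ i.2.1 *
              η ^ i.2.2.1 * (starRingEnd ℂ η) ^ i.2.2.2) ∧
        TendstoUniformlyOn
          (fun (s : Finset (ℕ × ℕ × ℕ × ℕ)) (v : ℂ × ℂ) =>
            ∑ i ∈ s, (a i : ℂ) * v.1 ^ i.1 * (starRingEnd ℂ v.1) ^ i.2.1 *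
              v.2 ^ i.2.2.1 * (starRingEnd ℂ v.2) ^ i.2.2.2)
          (fun v => f v.1 v.2) Filter.atTop
          (Metric.closedBall 0 1 ×ˢ Metric.closedBall 0 1) := by
  have hterm : ∀ (a : ℕ × ℕ × ℕ × ℕ → ℝ) (ξ η : ℂ) (i : ℕ × ℕ × ℕ × ℕ),
      (a i : ℂ) * ξ ^ i.1 * (starRingEnd ℂ ξ) ^ i.2.1 * η ^ i.2.2.1 * (starRingEnd ℂ η) ^ i.2.2.2
        = (a i : ℂ) * bidiscMonomial ξ η i := by
    intro a ξ η i
    simp only [bidiscMonomial, mul_assoc]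
  simp only [hterm]
  constructor
  · intro hPD
    obtain ⟨a, ha0, ha, hexp⟩ := exists_expansion_of_PDonProd hf hPD
    refine ⟨a, ha0, ha, hexp, ?_⟩
    have hunif : TendstoUniformlyOn
        (fun (s : Finset (ℕ × ℕ × ℕ × ℕ)) (v : ℂ × ℂ) =>
          ∑ i ∈ s, (a i : ℂ) * bidiscMonomial v.1 v.2 i)
        (fun v => ∑' i, (a i : ℂ) * bidiscMonomial v.1 v.2 i) atTop
        (Metric.closedBall 0 1 ×ˢ Metric.closedBall 0 1) := by
      refine tendstoUniformlyOn_tsum ha fun i v hv => ?_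
      rw [norm_mul, Complex.norm_real, Real.norm_of_nonneg (ha0 i)]
      exact mul_le_of_le_one_right (ha0 i) (norm_bidiscMonomial_le_one
        (mem_closedBall_zero_iff.1 hv.1) (mem_closedBall_zero_iff.1 hv.2) i)
    exact hunif.congr_right fun v hv => (hexp v.1 hv.1 v.2 hv.2).symm
  · rintro ⟨a, ha0, ha, hexp, -⟩
    exact PDonProd_of_expansion ha0 ha hexp

end
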